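/- For every c ≥ 0, sup_{z ∈ ℝ^d} ( c|z| − L(z) ) = sup_{w ∈ ℝ^d, |w| ≤ c} H(w). In particular, for every r > 0 and x ∈ ℝ^d, min_{y ∈ ℝ^d} { r·L((x−y)/r) − c|x−y| } = − r · sup_{|w| ≤ c} H(w). -/

import Mathlib

open Filter Set
open scoped RealInnerProductSpace

/-- The Legendre transform `L(q) = sup_p (⟨p,q⟩ - H(p))` of a function
`H : ℝ^d → ℝ`. -/
noncomputable def legendreTransform {d : ℕ} (H : EuclideanSpace ℝ (Fin d) → ℝ)
    (q : EuclideanSpace ℝ (Fin d)) : ℝ :=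
  ⨆ p : EuclideanSpace ℝ (Fin d), (⟪p, q⟫ - H p)

/-- A continuous convex function on a real inner product space has a subgradient at every point. -/
lemma ConvexOn.exists_subgradient {E : Type*} [NormedAddCommGroup E] [InnerProductSpace ℝ E]
    [CompleteSpace E] {f : E → ℝ} (hf : ConvexOn ℝ Set.univ f) (hcont : Continuous f) (w : E) :
    ∃ z : E, ∀ p, f w + ⟪p - w, z⟫ ≤ f p := by
  have hopen : IsOpen {p : E × ℝ | p.1 ∈ Set.univ ∧ f p.1 < p.2} := by
    simpa using isOpen_lt (hcont.comp continuous_fst) continuous_snd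
  obtain ⟨l, hl⟩ := geometric_hahn_banach_open_point hf.convex_strict_epigraph hopen
    (x := (w, f w)) (by simp)
  have hsplit (v : E) (t : ℝ) : l (v, t) = l (v, 0) + t * l (0, 1) := by
    rw [← smul_eq_mul, ← map_smul, ← map_add]
    simp
  have hb : l (0, 1) < 0 := by
    have h := hl (w, f w + 1) (by simp)
    rw [hsplit w (f w + 1), hsplit w (f w)] at h
    linarith
  have hle (p : E) : l (p, 0) + f p * l (0, 1) ≤ l (w, 0) + f w * l (0, 1) := by
    refine le_of_forall_pos_lt_add fun ε hε => ?_
    have h := hl (p, f p + ε / (-l (0, 1)))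
      (by simpa using div_pos hε (neg_pos.2 hb))
    rw [hsplit p (f p + _), hsplit w (f w), add_mul, div_neg, neg_mul,
      div_mul_cancel₀ _ hb.ne] at h
    linarith
  refine ⟨(InnerProductSpace.toDual ℝ E).symm
    ((-l (0, 1))⁻¹ • l.comp (ContinuousLinearMap.inl ℝ E ℝ)), fun p => ?_⟩
  rw [real_inner_comm, InnerProductSpace.toDual_symm_apply]
  have hsub : l (p - w, 0) = l (p, 0) - l (w, 0) := by
    rw [← map_sub]
    simp
  have h : (-l (0, 1))⁻¹ * l (p - w, 0) ≤ f p - f w := by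
    rw [inv_mul_le_iff₀ (neg_pos.2 hb), hsub]
    linarith [hle p]
  rw [inv_neg, neg_mul] at h
  simp
  linarith

/-- The supremum defining the Legendre transform of a continuous superlinear function is finite. -/
lemma bddAbove_range_inner_sub {d : ℕ} {H : EuclideanSpace ℝ (Fin d) → ℝ}
    (hcont : Continuous H)
    (hsuper : Tendsto (fun p : EuclideanSpace ℝ (Fin d) => H p / ‖p‖)
      (comap (fun p => ‖p‖) atTop) atTop) (q : EuclideanSpace ℝ (Fin d)) :
    BddAbove (Set.range fun p => ⟪p, q⟫ - H p) := by
  obtain ⟨R, -, hR⟩ := ((atTop_basis.comap _).eventually_iff).1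
    (hsuper.eventually_ge_atTop ‖q‖)
  obtain ⟨M, hM⟩ := (isCompact_closedBall (0 : EuclideanSpace ℝ (Fin d)) (max R 1)).bddAbove_image
    (f := fun p => ⟪p, q⟫ - H p) (by fun_prop)
  refine ⟨max M 0, ?_⟩
  rintro _ ⟨p, rfl⟩
  by_cases hp : ‖p‖ ≤ max R 1
  · exact le_max_of_le_left (hM (Set.mem_image_of_mem _ (by simpa using hp)))
  · obtain ⟨hRp, hp1⟩ := max_lt_iff.1 (not_le.1 hp)
    have h : ‖q‖ ≤ H p / ‖p‖ := hR (by simpa using hRp.le)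
    rw [le_div_iff₀ (by linarith)] at h
    have := real_inner_le_norm p q
    exact le_max_of_le_right (by dsimp only; linarith)

/-- The supremum of `c‖z‖ - L(z)` is attained and equals the supremum of `H` over the closed ball
of radius `c`. -/
lemma isGreatest_range_mul_norm_sub_legendreTransform {d : ℕ}
    {H : EuclideanSpace ℝ (Fin d) → ℝ} (hconv : ConvexOn ℝ Set.univ H)
    (hsuper : Tendsto (fun p : EuclideanSpace ℝ (Fin d) => H p / ‖p‖)
      (comap (fun p => ‖p‖) atTop) atTop) {c : ℝ} (hc : 0 ≤ c) :
    IsGreatest (Set.range fun z => c * ‖z‖ - legendreTransform H z)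
      (sSup (H '' Metric.closedBall 0 c)) := by
  have hcont : Continuous H := hconv.locallyLipschitz.continuous
  have hcompact := isCompact_closedBall (0 : EuclideanSpace ℝ (Fin d)) c
  have hbdd : BddAbove (H '' Metric.closedBall 0 c) := hcompact.bddAbove_image hcont.continuousOn
  have hupper : ∀ z, c * ‖z‖ - legendreTransform H z ≤ sSup (H '' Metric.closedBall 0 c) := by
    intro z
    obtain ⟨w, hw, hwz⟩ : ∃ w : EuclideanSpace ℝ (Fin d), ‖w‖ ≤ c ∧ ⟪w, z⟫ = c * ‖z‖ := by
      rcases eq_or_ne z 0 with rfl | hz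
      · exact ⟨0, by simpa using hc, by simp⟩
      · have hz' : ‖z‖ ≠ 0 := norm_ne_zero_iff.2 hz
        refine ⟨(c / ‖z‖) • z, ?_, ?_⟩
        · rw [norm_smul, Real.norm_of_nonneg (by positivity), div_mul_cancel₀ _ hz']
        · rw [real_inner_smul_left, real_inner_self_eq_norm_sq]
          field_simp
    have h1 : ⟪w, z⟫ - H w ≤ legendreTransform H z :=
      le_ciSup (bddAbove_range_inner_sub hcont hsuper z) w
    have h2 : H w ≤ sSup (H '' Metric.closedBall 0 c) :=
      le_csSup hbdd (Set.mem_image_of_mem _ (by simpa using hw))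
    linarith
  obtain ⟨w, hw, hwsup⟩ := hcompact.exists_sSup_image_eq ⟨0, by simpa using hc⟩ hcont.continuousOn
  obtain ⟨z, hz⟩ := hconv.exists_subgradient hcont w
  refine ⟨⟨z, le_antisymm (hupper z) ?_⟩, by rintro _ ⟨z, rfl⟩; exact hupper z⟩
  have hL : legendreTransform H z ≤ ⟪w, z⟫ - H w := ciSup_le fun p => by
    have h := hz p
    rw [inner_sub_left] at h
    linarith
  have h : ⟪w, z⟫ ≤ c * ‖z‖ := (real_inner_le_norm w z).trans
    (mul_le_mul_of_nonneg_right (by simpa using hw) (norm_nonneg z))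
  rw [hwsup]
  linarith

/-- For a convex superlinear `H` with Legendre transform `L`, for every `c ≥ 0` one has
`sup_z (c|z| − L(z)) = sup_{|w| ≤ c} H(w)`, and consequently for every `r > 0` and `x`,
`min_y { r·L((x−y)/r) − c|x−y| } = − r · sup_{|w| ≤ c} H(w)`. -/
theorem stmt_2 {d : ℕ} (H : EuclideanSpace ℝ (Fin d) → ℝ)
    (hHconv : ConvexOn ℝ Set.univ H)
    (hHsuper : Tendsto (fun p : EuclideanSpace ℝ (Fin d) => H p / ‖p‖)
      (comap (fun p => ‖p‖) atTop) atTop)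
    (c : ℝ) (hc : 0 ≤ c) :
    (⨆ z : EuclideanSpace ℝ (Fin d), (c * ‖z‖ - legendreTransform H z)) =
      sSup (H '' Metric.closedBall 0 c) ∧
    ∀ (r : ℝ), 0 < r → ∀ x : EuclideanSpace ℝ (Fin d),
      (⨅ y : EuclideanSpace ℝ (Fin d),
          (r * legendreTransform H (r⁻¹ • (x - y)) - c * ‖x - y‖)) =
        -(r * sSup (H '' Metric.closedBall 0 c)) := by
  have hmax := isGreatest_range_mul_norm_sub_legendreTransform hHconv hHsuper hc
  refine ⟨hmax.csSup_eq, fun r hr x => IsLeast.csInf_eq ⟨?_, ?_⟩⟩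
  · obtain ⟨z, hz⟩ := hmax.1
    refine ⟨x - r • z, ?_⟩
    rw [← hz]
    simp only [sub_sub_cancel, inv_smul_smul₀ hr.ne', norm_smul, Real.norm_of_nonneg hr.le]
    ring
  · rintro _ ⟨y, rfl⟩
    have h := mul_le_mul_of_nonneg_left (hmax.2 ⟨r⁻¹ • (x - y), rfl⟩) hr.le
    have hnorm : r * (c * ‖r⁻¹ • (x - y)‖) = c * ‖x - y‖ := by
      rw [norm_smul, Real.norm_of_nonneg (inv_nonneg.2 hr.le)]
      field_simp
    rw [mul_sub, hnorm] at h
    dsimp only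
    linarith
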